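/- Let G be a finite simple graph, let M be a matching in G, let P be an augmenting path in G with respect to M, and let Q be an augmenting path in G with respect to M△P. Then every vertex that has degree exactly 2 in the graph with edge set P△Q has exactly one of its two incident P△Q-edges belonging to M. -/

import Mathlib

open scoped Classical symmDiff

/-- `M` is a matching in the simple graph `G`: a set of edges of `G`
no two of which share an endpoint. -/
def IsMatching {V : Type*} (G : SimpleGraph V) (M : Finset (Sym2 V)) : Prop :=
  (M : Set (Sym2 V)) ⊆ G.edgeSet ∧
    ∀ e ∈ M, ∀ f ∈ M, e ≠ f → ∀ v : V, v ∈ e → v ∉ f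

/-- A vertex is matched by `M` if it is an endpoint of some edge of `M`. -/
def Matched {V : Type*} (M : Finset (Sym2 V)) (v : V) : Prop :=
  ∃ e ∈ M, v ∈ e

/-- A list of edges alternates with respect to the matching `M`. -/
def Alternating {V : Type*} (M : Finset (Sym2 V)) (l : List (Sym2 V)) : Prop :=
  ∀ (i : ℕ) (h : i + 1 < l.length), ((l[i]'(by omega)) ∈ M ↔ (l[i + 1]'h) ∉ M)

/-- `p` is an augmenting path in `G` with respect to the matching `M`:
a path with at least one edge, both of whose endpoints are exposed, and whose
edges alternate between edges not in `M` and edges in `M`. -/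
structure IsAugPath {V : Type*} (G : SimpleGraph V) (M : Finset (Sym2 V))
    {a b : V} (p : G.Walk a b) : Prop where
  isPath : p.IsPath
  pos : 0 < p.length
  expA : ¬ Matched M a
  expB : ¬ Matched M b
  alt : Alternating M p.edges


/-- The degree of a vertex `v` in the graph whose edge set is the finite edge set
`S`: the number of edges of `S` containing `v`. -/
noncomputable def edgeDeg {V : Type*} (S : Finset (Sym2 V)) (v : V) : ℕ :=
  (S.filter (fun e => v ∈ e)).card

/-- Alternation passes to the tail of a list of edges. -/
theorem Alternating.tail {V : Type*} {M : Finset (Sym2 V)} {e : Sym2 V} {l : List (Sym2 V)}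
    (h : Alternating M (e :: l)) : Alternating M l := by
  intro i hi
  exact h (i + 1) (by simpa using hi)

/-- The first two edges of an alternating list are not both in or both outside `M`. -/
theorem Alternating.head {V : Type*} {M : Finset (Sym2 V)} {e f : Sym2 V} {l : List (Sym2 V)}
    (h : Alternating M (e :: f :: l)) : e ∈ M ↔ f ∉ M := by
  simpa using h 0 (by simp)

/-- Two distinct edges of an alternating path that share a vertex are not both in or both
outside `M`. -/
theorem Alternating.mem_iff_notMem {V : Type*} {G : SimpleGraph V} {M : Finset (Sym2 V)}
    {a b : V} {p : G.Walk a b} (hp : p.IsPath) (h : Alternating M p.edges)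
    {v : V} {e f : Sym2 V} (he : e ∈ p.edges) (hf : f ∈ p.edges) (hne : e ≠ f)
    (hve : v ∈ e) (hvf : v ∈ f) : e ∈ M ↔ f ∉ M := by
  induction p generalizing e f with
  | nil => simp at he
  | @cons u w b huw p ih =>
    rw [SimpleGraph.Walk.cons_isPath_iff] at hp
    rw [SimpleGraph.Walk.edges_cons] at h he hf
    have first : ∀ g ∈ p.edges, v ∈ s(u, w) → v ∈ g → (s(u, w) ∈ M ↔ g ∉ M) := by
      intro g hg hv hvg
      have hvp : v ∈ p.support := p.mem_support_of_mem_edges hg hvg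
      have hvw : v = w := by
        rcases Sym2.mem_iff.1 hv with rfl | rfl
        · exact absurd hvp hp.2
        · rfl
      subst hvw
      cases p with
      | nil => simp at hg
      | cons hwx q =>
        rw [SimpleGraph.Walk.edges_cons] at h hg
        rcases List.mem_cons.1 hg with rfl | hg
        · exact h.head
        · exact absurd (q.mem_support_of_mem_edges hg hvg)
            ((SimpleGraph.Walk.cons_isPath_iff _ _).1 hp.1).2
    rcases List.mem_cons.1 he with rfl | he <;> rcases List.mem_cons.1 hf with rfl | hf
    · exact absurd rfl hne
    · exact first f hf hve hvf
    · have := first e he hvf hve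
      tauto
    · exact ih hp.1 h.tail he hf hne hve hvf

/-- An inner vertex of an alternating walk is matched by an edge of the walk. -/
theorem Alternating.exists_mem_edges {V : Type*} {G : SimpleGraph V} {M : Finset (Sym2 V)}
    {a b : V} {p : G.Walk a b} (h : Alternating M p.edges) {v : V} (hv : v ∈ p.support)
    (hva : v ≠ a) (hvb : v ≠ b) : ∃ e ∈ p.edges, e ∈ M ∧ v ∈ e := by
  induction p with
  | nil => simp at hv; exact absurd hv hva
  | @cons u w b huw p ih =>
    rw [SimpleGraph.Walk.edges_cons] at h ⊢
    have hvp : v ∈ p.support := by simpa [hva] using hv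
    by_cases hvw : v = w
    · subst hvw
      cases p with
      | nil => exact absurd rfl hvb
      | @cons _ x _ hwx q =>
        rw [SimpleGraph.Walk.edges_cons] at h ⊢
        by_cases hM : s(u, v) ∈ M
        · exact ⟨s(u, v), by simp, hM, by simp⟩
        · exact ⟨s(v, x), by simp, by simpa [hM] using h.head, by simp⟩
    · obtain ⟨e, he, heM, hve⟩ := ih h.tail hvp hvw hvb
      exact ⟨e, List.mem_cons_of_mem _ he, heM, hve⟩

/-- Two edges of a matching with a common endpoint are equal. -/
theorem IsMatching.eq {V : Type*} {G : SimpleGraph V} {M : Finset (Sym2 V)}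
    (hM : IsMatching G M) {e f : Sym2 V} (he : e ∈ M) (hf : f ∈ M) {v : V}
    (hve : v ∈ e) (hvf : v ∈ f) : e = f := by
  by_contra hne
  exact hM.2 e he f hf hne v hve hvf

/-- Augmenting a matching along an augmenting path gives a matching. -/
theorem IsAugPath.isMatching_symmDiff {V : Type*} [DecidableEq V] {G : SimpleGraph V}
    {M : Finset (Sym2 V)} (hM : IsMatching G M) {a b : V} {p : G.Walk a b}
    (hp : IsAugPath G M p) : IsMatching G (M ∆ p.edges.toFinset) := by
  have mixed : ∀ e ∈ M, e ∉ p.edges → ∀ f ∈ p.edges, ∀ v ∈ e, v ∉ f := by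
    intro e heM hep f hfp v hve hvf
    obtain ⟨g, hgp, hgM, hvg⟩ := hp.alt.exists_mem_edges
      (p.mem_support_of_mem_edges hfp hvf)
      (by rintro rfl; exact hp.expA ⟨e, heM, hve⟩)
      (by rintro rfl; exact hp.expB ⟨e, heM, hve⟩)
    exact hep (hM.eq heM hgM hve hvg ▸ hgp)
  refine ⟨fun e he => ?_, fun e he f hf hne v hve hvf => ?_⟩
  · rw [Finset.mem_coe, Finset.mem_symmDiff, List.mem_toFinset] at he
    rcases he with he | he
    · exact hM.1 he.1
    · exact p.edges_subset_edgeSet he.1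
  · rw [Finset.mem_symmDiff, List.mem_toFinset] at he hf
    rcases he with ⟨heM, hep⟩ | ⟨hep, heM⟩ <;> rcases hf with ⟨hfM, hfp⟩ | ⟨hfp, hfM⟩
    · exact hne (hM.eq heM hfM hve hvf)
    · exact mixed e heM hep f hfp v hve hvf
    · exact mixed f hfM hfp e hep v hvf hve
    · exact heM ((hp.alt.mem_iff_notMem hp.isPath hep hfp hne hve hvf).2 hfM)

/-- If `P` is an augmenting path with respect to the matching `M` and `Q` is an
augmenting path with respect to `M △ P`, then every vertex of degree exactly `2`
in the graph with edge set `P △ Q` has exactly one of its two incident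
`P △ Q`-edges belonging to `M`. -/
theorem stmt6 {V : Type*} [Fintype V] [DecidableEq V] (G : SimpleGraph V)
    (M : Finset (Sym2 V)) (hM : IsMatching G M)
    {a b : V} (P : G.Walk a b) (hP : IsAugPath G M P)
    {c d : V} (Q : G.Walk c d) (hQ : IsAugPath G (M ∆ P.edges.toFinset) Q) :
    ∀ v : V, edgeDeg (P.edges.toFinset ∆ Q.edges.toFinset) v = 2 →
      (((P.edges.toFinset ∆ Q.edges.toFinset).filter (fun e => v ∈ e)).filter
        (fun e => e ∈ M)).card = 1 := by
  intro v hdeg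
  have hM' := hQ.isMatching_symmDiff (hP.isMatching_symmDiff hM)
  rw [symmDiff_assoc] at hM'
  generalize P.edges.toFinset ∆ Q.edges.toFinset = D at hdeg hM' ⊢
  have hcard : (D.filter (fun e => v ∈ e)).card = 2 := by
    rw [← hdeg, edgeDeg]
    congr
  have hin : ((D.filter (fun e => v ∈ e)).filter (fun e => e ∈ M)).card ≤ 1 := by
    refine Finset.card_le_one.2 fun e he f hf => ?_
    simp only [Finset.mem_filter] at he hf
    exact hM.eq he.2 hf.2 he.1.2 hf.1.2
  have hout : ((D.filter (fun e => v ∈ e)).filter (fun e => ¬ e ∈ M)).card ≤ 1 := by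
    refine Finset.card_le_one.2 fun e he f hf => ?_
    simp only [Finset.mem_filter] at he hf
    exact hM'.eq (Finset.mem_symmDiff.2 (Or.inr ⟨he.1.1, he.2⟩))
      (Finset.mem_symmDiff.2 (Or.inr ⟨hf.1.1, hf.2⟩)) he.1.2 hf.1.2
  have hsum := Finset.card_filter_add_card_filter_not (s := D.filter (fun e => v ∈ e))
    (fun e => e ∈ M)
  omega
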